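/- Let 1 ≤ p < ∞ and 0 < δ < 1 with pδ ≥ 1, and let τ = 1. Then there exists a John domain G ⊂ ℝ² for which no constant C > 0 satisfies ∫_G ∫_G |u(x) − u(y)|^p / |x − y|^{2+δp} dy dx ≤ C ∫_G ∫_{B(x, τ·dist(x,∂G))} |u(x) − u(y)|^p / |x − y|^{2+δp} dy dx for every u ∈ L¹(G); in fact there is a u ∈ L¹(G) for which the right-hand side is finite and the left-hand side is infinite. -/

import Mathlib

open MeasureTheory Metric Set ENNReal

/-- A bounded domain `G ⊆ ℝⁿ` is a `c`-John domain if there is a John center `x₀ ∈ G`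
such that every `x ∈ G` is joined to `x₀` by a rectifiable curve, parametrized by arc
length (formalized as a `1`-Lipschitz parametrization on `[0, ℓ]`), along which
`dist(γ t, ∂G) ≥ t / c`. -/
def IsJohnDomain {n : ℕ} (c : ℝ) (G : Set (EuclideanSpace ℝ (Fin n))) : Prop :=
  1 ≤ c ∧ IsOpen G ∧ IsConnected G ∧ Bornology.IsBounded G ∧
    ∃ x₀ ∈ G, ∀ x ∈ G, ∃ ℓ : ℝ, 0 ≤ ℓ ∧ ∃ γ : ℝ → EuclideanSpace ℝ (Fin n),
      γ 0 = x ∧ γ ℓ = x₀ ∧ (∀ t ∈ Set.Icc 0 ℓ, γ t ∈ G) ∧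
      (∀ s ∈ Set.Icc 0 ℓ, ∀ t ∈ Set.Icc 0 ℓ, dist (γ s) (γ t) ≤ |s - t|) ∧
      (∀ t ∈ Set.Icc 0 ℓ, t / c ≤ Metric.infDist (γ t) (frontier G))

namespace SlitDisc

local notation "E" => EuclideanSpace ℝ (Fin 2)

/-- The open upper half of the unit disc. -/
def upper : Set E := ball 0 1 ∩ {x | 0 < x 1}

/-- The open lower half of the unit disc. -/
def lower : Set E := ball 0 1 ∩ {x | x 1 < 0}

/-- The John center of the slit disc. -/
noncomputable def center : E := !₂[-1 / 2, 0]

/-- A disc in the left half of the unit disc, joining the upper and the lower half discs. -/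
def bridge : Set E := ball center (1 / 2)

/-- The unit disc slit along the nonnegative horizontal axis. -/
def domain : Set E := upper ∪ lower ∪ bridge

/-- The positive part of the horizontal coordinate on the upper half plane, extended by zero. -/
noncomputable def jump (x : E) : ℝ := if 0 < x 1 then max 0 (x 0) else 0

lemma mem_ball_iff {x c : E} {r : ℝ} (hr : 0 < r) :
    x ∈ ball c r ↔ (x 0 - c 0) ^ 2 + (x 1 - c 1) ^ 2 < r ^ 2 := by
  rw [mem_ball, EuclideanSpace.dist_eq, Real.sqrt_lt' hr]
  simp [Real.dist_eq, sq_abs]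

lemma abs_coord_sub_le (x y : E) (i : Fin 2) : |x i - y i| ≤ dist x y := by
  rw [dist_eq_norm]
  exact PiLp.norm_apply_le (x - y) i

lemma isOpen_upper : IsOpen upper :=
  isOpen_ball.inter (isOpen_lt continuous_const (by fun_prop))

lemma isOpen_lower : IsOpen lower :=
  isOpen_ball.inter (isOpen_lt (by fun_prop) continuous_const)

lemma isOpen_domain : IsOpen domain :=
  (isOpen_upper.union isOpen_lower).union isOpen_ball

lemma convex_upper : Convex ℝ upper :=
  (convex_ball _ _).inter
    (convex_halfSpace_gt (f := fun x : E => x 1) ⟨fun _ _ => rfl, fun _ _ => rfl⟩ 0)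

lemma convex_lower : Convex ℝ lower :=
  (convex_ball _ _).inter
    (convex_halfSpace_lt (f := fun x : E => x 1) ⟨fun _ _ => rfl, fun _ _ => rfl⟩ 0)

lemma convex_bridge : Convex ℝ bridge := convex_ball _ _

lemma bridge_subset : bridge ⊆ ball 0 1 := by
  intro x hx
  rw [bridge, mem_ball_iff (by norm_num)] at hx
  rw [mem_ball_iff one_pos]
  simp only [center, PiLp.zero_apply, PiLp.toLp_apply, Matrix.cons_val_zero,
    Matrix.cons_val_one] at hx ⊢
  nlinarith [sq_nonneg (x 0), sq_nonneg (x 1), sq_nonneg (x 0 + 1)]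

lemma neg_of_mem_bridge {x : E} (hx : x ∈ bridge) : x 0 < 0 := by
  rw [bridge, mem_ball_iff (by norm_num)] at hx
  simp only [center, PiLp.toLp_apply, Matrix.cons_val_zero, Matrix.cons_val_one] at hx
  nlinarith [sq_nonneg (x 1), sq_nonneg (x 0)]

lemma domain_subset : domain ⊆ ball 0 1 :=
  union_subset (union_subset inter_subset_left inter_subset_left) bridge_subset

lemma center_mem : center ∈ domain := Or.inr (mem_ball_self (by norm_num))

/-- A ball about the left vertical midpoint at height `a` is contained in the bridge. -/
lemma ball_subset_bridge {a : ℝ} (ha : |a| ≤ 1 / 4) :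
    ball (!₂[-1 / 2, a] : E) (1 / 8) ⊆ bridge := by
  refine ball_subset_ball' ?_
  rw [center, EuclideanSpace.dist_eq]
  simp only [Fin.sum_univ_two, Matrix.cons_val_zero, Matrix.cons_val_one, Matrix.cons_val_fin_one,
    Real.dist_eq, sub_zero]
  rw [sub_self, abs_zero, zero_pow two_ne_zero, zero_add, Real.sqrt_sq (abs_nonneg _)]
  linarith

lemma ball_subset_upper : ball (!₂[-1 / 2, 1 / 4] : E) (1 / 8) ⊆ upper := by
  intro x hx
  refine ⟨bridge_subset (ball_subset_bridge (by norm_num [abs_of_pos]) hx), ?_⟩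
  have := (abs_coord_sub_le x _ 1).trans_lt (mem_ball.1 hx)
  simp only [Matrix.cons_val_one, Matrix.cons_val_fin_one] at this
  have := (abs_lt.1 this).1
  simp only [mem_ofPred_eq]
  linarith

lemma ball_subset_lower : ball (!₂[-1 / 2, -1 / 4] : E) (1 / 8) ⊆ lower := by
  intro x hx
  refine ⟨bridge_subset (ball_subset_bridge (by norm_num [abs_of_neg]) hx), ?_⟩
  have := (abs_coord_sub_le x _ 1).trans_lt (mem_ball.1 hx)
  simp only [Matrix.cons_val_one, Matrix.cons_val_fin_one] at this
  have := (abs_lt.1 this).2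
  simp only [mem_ofPred_eq]
  linarith

lemma frontier_nonempty : (frontier domain).Nonempty := by
  refine nonempty_frontier_iff.2 ⟨⟨_, center_mem⟩, fun h => ?_⟩
  have : (!₂[1, 0] : E) ∈ ball (0 : E) 1 := domain_subset (h ▸ mem_univ _)
  rw [mem_ball_iff one_pos] at this
  simp at this

lemma le_infDist_frontier {x : E} {r : ℝ} (h : ball x r ⊆ domain) :
    r ≤ infDist x (frontier domain) := by
  rw [le_infDist frontier_nonempty]
  intro y hy
  by_contra! hlt
  exact disjoint_left.1 (disjoint_frontier_iff_isOpen.2 isOpen_domain) hy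
    (h (mem_ball'.2 hlt))

lemma ball_infDist_subset {x : E} (hx : x ∈ domain) :
    ball x (infDist x (frontier domain)) ⊆ domain := by
  rcases (infDist_nonneg (x := x) (s := frontier domain)).eq_or_lt with h0 | h0
  · simp [← h0]
  refine IsPreconnected.subset_left_of_subset_union isOpen_domain
    isClosed_closure.isOpen_compl (disjoint_compl_right.mono_left subset_closure) ?_
    ⟨x, mem_ball_self h0, hx⟩ (convex_ball _ _).isPreconnected
  intro y hy
  by_cases hyc : y ∈ closure domain
  · rw [closure_eq_self_union_frontier] at hyc
    exact Or.inl (hyc.resolve_right (ball_infDist_subset_compl hy))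
  · exact Or.inr hyc

/-- The part of the cone over a ball with apex `x` at relative distance `s` from the apex. -/
lemma ball_lineMap_subset {K : Set E} (hK : Convex ℝ K) {x P : E} {r s : ℝ} (hx : x ∈ K)
    (hP : ball P r ⊆ K) (hs0 : 0 ≤ s) (hs1 : s ≤ 1) :
    ball (AffineMap.lineMap x P s) (s * r) ⊆ K := by
  intro y hy
  rcases hs0.eq_or_lt with rfl | hs
  · simp at hy
  have hz : P + s⁻¹ • (y - AffineMap.lineMap x P s) ∈ K := by
    apply hP
    rw [mem_ball, dist_eq_norm, add_sub_cancel_left, norm_smul, norm_inv, Real.norm_of_nonneg hs0,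
      ← dist_eq_norm, inv_mul_lt_iff₀ hs]
    exact hy
  have := hK.lineMap_mem hx hz ⟨hs0, hs1⟩
  convert this using 1
  simp only [AffineMap.lineMap_apply_module, smul_add, smul_smul, mul_inv_cancel₀ hs.ne', one_smul]
  abel

lemma john_curve {K : Set E} (hK : Convex ℝ K) (hKG : K ⊆ domain) {x : E} {a : ℝ}
    (hx : x ∈ K) (ha : |a| ≤ 1 / 4) (hP : ball (!₂[-1 / 2, a] : E) (1 / 8) ⊆ K) :
    ∃ ℓ : ℝ, 0 ≤ ℓ ∧ ∃ γ : ℝ → E,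
      γ 0 = x ∧ γ ℓ = center ∧ (∀ t ∈ Set.Icc 0 ℓ, γ t ∈ domain) ∧
      (∀ s ∈ Set.Icc 0 ℓ, ∀ t ∈ Set.Icc 0 ℓ, dist (γ s) (γ t) ≤ |s - t|) ∧
      (∀ t ∈ Set.Icc 0 ℓ, t / 32 ≤ Metric.infDist (γ t) (frontier domain)) := by
  set P : E := !₂[-1 / 2, a] with hPdef
  have hPK : P ∈ K := hP (mem_ball_self (by norm_num))
  have hball (s : ℝ) (hs : s ∈ Icc (0 : ℝ) 1) :
      ball (AffineMap.lineMap P center s) (1 / 8) ⊆ domain := by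
    have : AffineMap.lineMap P center s = (!₂[-1 / 2, (1 - s) * a] : E) := by
      ext i
      fin_cases i <;> simp [AffineMap.lineMap_apply_module, hPdef, center]
      ring
    rw [this]
    refine (ball_subset_bridge ?_).trans subset_union_right
    rw [abs_mul, abs_of_nonneg (by linarith [hs.2])]
    nlinarith [hs.1, hs.2, abs_nonneg a]
  have hdist {y z : E} (hy : y ∈ domain) (hz : z ∈ domain) : dist y z ≤ 2 := by
    have := mem_ball.1 (domain_subset hy)
    have := mem_ball.1 (domain_subset hz)
    linarith [dist_triangle_right y z 0]
  have hxP : ‖P - x‖ ≤ 2 := dist_eq_norm P x ▸ hdist (hKG hPK) (hKG hx)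
  have hPc : ‖center - P‖ ≤ 2 := dist_eq_norm center P ▸ hdist center_mem (hKG hPK)
  refine ⟨4, by norm_num, fun t => AffineMap.lineMap x P (min t 2 / 2) +
    (max (t - 2) 0 / 2) • (center - P), by norm_num, ?_, ?_, ?_, ?_⟩
  · norm_num
  · intro t ht
    rcases le_total t 2 with h | h
    · simp only [min_eq_left h, max_eq_right (sub_nonpos.2 h), zero_div, zero_smul, add_zero]
      exact hKG (hK.lineMap_mem hx hPK ⟨by linarith [ht.1], by linarith⟩)
    · have := hball ((t - 2) / 2) ⟨by linarith, by linarith [ht.2]⟩ (mem_ball_self (by norm_num))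
      simpa [min_eq_right h, max_eq_left (sub_nonneg.2 h), AffineMap.lineMap_apply, add_comm]
        using this
  · intro s _ t _
    wlog hst : s ≤ t generalizing s t
    · rw [dist_comm, abs_sub_comm]
      exact this t ‹_› s ‹_› (le_of_not_ge hst)
    have hm : min s 2 ≤ min t 2 := min_le_min_right _ hst
    have hM : max (s - 2) 0 ≤ max (t - 2) 0 := max_le_max_right _ (by linarith)
    have hsum : (min t 2 - min s 2) + (max (t - 2) 0 - max (s - 2) 0) = t - s := by
      have (r : ℝ) : min r 2 + max (r - 2) 0 = r := by
        rcases le_total r 2 with h | h <;> simp [h]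
      linarith [this s, this t]
    refine (dist_add_add_le _ _ _ _).trans ?_
    rw [dist_lineMap_lineMap, dist_eq_norm (_ • _), ← sub_smul, norm_smul, dist_comm x,
      dist_eq_norm P, Real.dist_eq, Real.norm_eq_abs, abs_sub_comm, abs_sub_comm (max _ _ / 2),
      abs_sub_comm s, abs_of_nonneg (by linarith), abs_of_nonneg (by linarith),
      abs_of_nonneg (by linarith : 0 ≤ t - s)]
    nlinarith
  · intro t ht
    rcases le_total t 2 with h | h
    · simp only [min_eq_left h, max_eq_right (sub_nonpos.2 h), zero_div, zero_smul, add_zero]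
      have := le_infDist_frontier ((ball_lineMap_subset hK hx hP (s := t / 2)
        (by linarith [ht.1]) (by linarith)).trans hKG)
      linarith [ht.1]
    · have := le_infDist_frontier (hball ((t - 2) / 2) ⟨by linarith, by linarith [ht.2]⟩)
      simp only [min_eq_right h, max_eq_left (sub_nonneg.2 h), AffineMap.lineMap_apply, div_self,
        one_smul, vsub_eq_sub, vadd_eq_add, sub_add_cancel, ne_eq, OfNat.ofNat_ne_zero,
        not_false_eq_true] at this ⊢
      rw [add_comm]
      linarith [ht.2]

lemma isJohnDomain_domain : IsJohnDomain 32 domain := by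
  refine ⟨by norm_num, isOpen_domain, ⟨⟨_, center_mem⟩, ?_⟩,
    isBounded_ball.subset domain_subset, center, center_mem, ?_⟩
  · have hb : IsPreconnected bridge := convex_bridge.isPreconnected
    have hself {a : ℝ} : (!₂[-1 / 2, a] : E) ∈ ball (!₂[-1 / 2, a] : E) (1 / 8) :=
      mem_ball_self (by norm_num)
    have hu : IsPreconnected (upper ∪ bridge) := convex_upper.isPreconnected.union _
      (ball_subset_upper hself) (ball_subset_bridge (by norm_num [abs_of_pos]) hself) hb
    have := convex_lower.isPreconnected.union _ (ball_subset_lower hself)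
      (Or.inr (ball_subset_bridge (by norm_num [abs_of_neg]) hself)) hu
    convert this using 1
    rw [domain, union_comm upper, union_assoc]
  · rintro x ((hx | hx) | hx)
    · exact john_curve convex_upper (subset_union_left.trans subset_union_left) hx
        (by norm_num [abs_of_pos]) ball_subset_upper
    · exact john_curve convex_lower (subset_union_right.trans subset_union_left) hx
        (by norm_num [abs_of_neg]) ball_subset_lower
    · exact john_curve convex_bridge subset_union_right hx (a := 0) (by norm_num)
        (ball_subset_bridge (by norm_num))

lemma measurable_jump : Measurable jump := by
  refine Measurable.ite (measurableSet_lt measurable_const (by fun_prop)) ?_ measurable_const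
  fun_prop

lemma abs_jump_le {x : E} (hx : x ∈ domain) : |jump x| ≤ 1 := by
  have h1 : |x 0 - (0 : E) 0| ≤ 1 :=
    (abs_coord_sub_le x 0 0).trans (mem_ball.1 (domain_subset hx)).le
  have h2 : x 0 ≤ 1 := (abs_le.1 (by simpa using h1)).2
  unfold jump
  split_ifs
  · rw [abs_of_nonneg (le_max_left _ _)]
    exact max_le zero_le_one h2
  · simp

lemma integrableOn_jump : IntegrableOn jump domain volume := by
  refine Measure.integrableOn_of_bounded (M := 1)
    ((measure_mono domain_subset).trans_lt measure_ball_lt_top).ne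
    measurable_jump.aestronglyMeasurable ?_
  filter_upwards [ae_restrict_mem isOpen_domain.measurableSet] with x hx
  exact abs_jump_le hx

lemma abs_jump_sub_le_of_pos_of_nonpos {B : Set E} (hB : Convex ℝ B) (hBG : B ⊆ domain) {x y : E}
    (hx : x ∈ B) (hy : y ∈ B) (hx1 : 0 < x 1) (hy1 : y 1 ≤ 0) :
    |jump x - jump y| ≤ dist x y := by
  have hs1 : x 1 / (x 1 - y 1) ≤ 1 := (div_le_one (by linarith)).2 (by linarith)
  have hs0 : 0 ≤ x 1 / (x 1 - y 1) := div_nonneg hx1.le (by linarith)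
  set s := x 1 / (x 1 - y 1) with hs
  have hcoord (i : Fin 2) : (AffineMap.lineMap x y s : E) i = x i - s * (x i - y i) := by
    simp [AffineMap.lineMap_apply_module]
    ring
  have hz := hBG (hB.lineMap_mem hx hy ⟨hs0, hs1⟩)
  have hz1 : (AffineMap.lineMap x y s : E) 1 = 0 := by
    rw [hcoord, hs, div_mul_cancel₀ _ (by linarith), sub_self]
  have hz0 : (AffineMap.lineMap x y s : E) 0 < 0 := by
    rcases hz with (h | h) | h
    · exact absurd hz1 h.2.ne'
    · exact absurd hz1 h.2.ne
    · exact neg_of_mem_bridge h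
  rw [hcoord] at hz0
  have h := (le_abs_self _).trans (abs_coord_sub_le x y 0)
  rw [jump, jump, if_pos hx1, if_neg hy1.not_gt, sub_zero, abs_of_nonneg (le_max_left _ _)]
  refine max_le dist_nonneg ?_
  nlinarith [dist_nonneg (x := x) (y := y)]

/-- The jump function is `1`-Lipschitz on convex subsets of the slit disc. -/
lemma abs_jump_sub_le {B : Set E} (hB : Convex ℝ B) (hBG : B ⊆ domain) {x y : E}
    (hx : x ∈ B) (hy : y ∈ B) : |jump x - jump y| ≤ dist x y := by
  rcases lt_or_ge 0 (x 1) with hx1 | hx1 <;> rcases lt_or_ge 0 (y 1) with hy1 | hy1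
  · rw [jump, jump, if_pos hx1, if_pos hy1]
    refine le_trans ?_ (abs_coord_sub_le x y 0)
    simpa using abs_max_sub_max_le_max 0 (x 0) 0 (y 0)
  · exact abs_jump_sub_le_of_pos_of_nonpos hB hBG hx hy hx1 hy1
  · rw [abs_sub_comm, dist_comm]
    exact abs_jump_sub_le_of_pos_of_nonpos hB hBG hy hx hy1 hx1
  · simp [jump, hx1.not_gt, hy1.not_gt]

lemma lintegral_kernel_lt_top {q : ℝ} (hq : 0 < q) :
    ∫⁻ y in ball (0 : E) 2, ENNReal.ofReal (‖y‖ ^ (q - 2)) < ∞ := by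
  have : IntegrableOn (fun y : E => ‖y‖ ^ (q - 2)) (ball 0 2) volume := by
    refine integrableOn_ball_of_norm_le_rpow (C := 1) (α := 2 - q) (by simp) (by simpa) ?_
      (measurable_norm.pow_const _).aestronglyMeasurable
    refine Filter.Eventually.of_forall fun x => ?_
    rw [Real.norm_of_nonneg (by positivity), one_mul, neg_sub]
  exact this.lintegral_lt_top

lemma improved_lt_top {p δ : ℝ} (hp : 1 ≤ p) (hδ : δ ∈ Set.Ioo (0 : ℝ) 1) :
    ∫⁻ x in domain, ∫⁻ y in ball x (1 * infDist x (frontier domain)),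
      ENNReal.ofReal (|jump x - jump y| ^ p / dist x y ^ ((2 : ℝ) + δ * p)) < ∞ := by
  have hq : 0 < p * (1 - δ) := mul_pos (by linarith) (by linarith [hδ.2])
  set K := ∫⁻ y in ball (0 : E) 2, ENNReal.ofReal (‖y‖ ^ (p * (1 - δ) - 2)) with hK
  have hinner (x : E) (hx : x ∈ domain) :
      ∫⁻ y in ball x (1 * infDist x (frontier domain)),
        ENNReal.ofReal (|jump x - jump y| ^ p / dist x y ^ ((2 : ℝ) + δ * p)) ≤ K := by
    rw [one_mul]
    set B := ball x (infDist x (frontier domain)) with hB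
    have hBG : B ⊆ domain := ball_infDist_subset hx
    calc _ ≤ ∫⁻ y in B, ENNReal.ofReal (‖y - x‖ ^ (p * (1 - δ) - 2)) := by
          refine setLIntegral_mono' measurableSet_ball fun y hy => ENNReal.ofReal_le_ofReal ?_
          have hxB : x ∈ B := mem_ball_self (pos_of_mem_ball hy)
          have hL := abs_jump_sub_le (convex_ball _ _) hBG hxB hy
          rcases eq_or_ne x y with rfl | hne
          · rw [sub_self, abs_zero, Real.zero_rpow (by linarith), zero_div]
            positivity
          · have hd := dist_pos.2 hne
            rw [div_le_iff₀ (by positivity), ← dist_eq_norm, dist_comm y, ← Real.rpow_add hd]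
            refine (Real.rpow_le_rpow (abs_nonneg _) hL (by linarith)).trans_eq ?_
            ring_nf
      _ ≤ ∫⁻ y in ball x 2, ENNReal.ofReal (‖y - x‖ ^ (p * (1 - δ) - 2)) := by
          refine lintegral_mono_set fun y hy => ?_
          have h1 := mem_ball.1 (domain_subset (hBG hy))
          have h2 := mem_ball.1 (domain_subset hx)
          exact mem_ball.2 (by linarith [dist_triangle_right y x 0])
      _ = K := by
          rw [hK, ← lintegral_indicator measurableSet_ball, ← lintegral_indicator measurableSet_ball,
            ← lintegral_sub_right_eq_self ((ball (0 : E) 2).indicator _) x]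
          refine lintegral_congr fun y => ?_
          simp only [indicator, mem_ball, dist_eq_norm, sub_zero]
  calc _ ≤ ∫⁻ _ in domain, K := setLIntegral_mono' isOpen_domain.measurableSet hinner
    _ = K * volume domain := setLIntegral_const _ _
    _ < ∞ := ENNReal.mul_lt_top (lintegral_kernel_lt_top hq)
      ((measure_mono domain_subset).trans_lt measure_ball_lt_top)

/-- A small rectangle lying on the upper side of the slit. -/
def rect : Set E := {x | x 0 ∈ Ioo (1 / 4 : ℝ) (1 / 2) ∧ x 1 ∈ Ioo (0 : ℝ) (1 / 8)}

lemma rect_subset : rect ⊆ domain := by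
  rintro x ⟨⟨h1, h2⟩, h3, h4⟩
  refine Or.inl (Or.inl ⟨(mem_ball_iff one_pos).2 ?_, h3⟩)
  simp only [PiLp.zero_apply]
  nlinarith

lemma measurableSet_rect : MeasurableSet rect :=
  (measurableSet_Ioo.preimage (f := fun x : E => x 0) (by fun_prop)).inter
    (measurableSet_Ioo.preimage (f := fun x : E => x 1) (by fun_prop))

lemma lintegral_rect : ∫⁻ x in rect, ENNReal.ofReal (x 1 ^ (-1 : ℝ)) = ∞ := by
  have h1 : ∫⁻ s in Ioo (0 : ℝ) (1 / 8), ENNReal.ofReal (s ^ (-1 : ℝ)) = ∞ := by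
    by_contra h
    have hi : IntegrableOn (fun s : ℝ => s ^ (-1 : ℝ)) (Ioo 0 (1 / 8)) := by
      refine ⟨by fun_prop, ?_⟩
      rw [hasFiniteIntegral_iff_ofReal]
      · exact lt_top_iff_ne_top.2 h
      · filter_upwards [ae_restrict_mem measurableSet_Ioo] with s hs
        exact Real.rpow_nonneg hs.1.le _
    exact lt_irrefl _ ((intervalIntegral.integrableOn_Ioo_rpow_iff (by norm_num)).1 hi)
  have hmp := (volume_preserving_finTwoArrow ℝ).comp (PiLp.volume_preserving_ofLp (Fin 2))
  have hpre : rect = (MeasurableEquiv.finTwoArrow ∘ @WithLp.ofLp 2 (Fin 2 → ℝ)) ⁻¹'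
      (Ioo (1 / 4 : ℝ) (1 / 2) ×ˢ Ioo (0 : ℝ) (1 / 8)) := rfl
  have := hmp.setLIntegral_comp_preimage (measurableSet_Ioo.prod measurableSet_Ioo)
    (f := fun z : ℝ × ℝ => ENNReal.ofReal (z.2 ^ (-1 : ℝ)))
    (s := Ioo (1 / 4 : ℝ) (1 / 2) ×ˢ Ioo (0 : ℝ) (1 / 8)) (by fun_prop)
  rw [← hpre] at this
  refine this.trans ?_
  rw [Measure.volume_eq_prod, ← Measure.prod_restrict, lintegral_prod _ (by fun_prop)]
  simp only [h1, lintegral_const, Measure.restrict_apply_univ, Real.volume_Ioo]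
  rw [ENNReal.top_mul]
  norm_num

lemma full_inner_ge {p δ : ℝ} (hp : 1 ≤ p) (hpδ : 1 ≤ p * δ) {x : E} (hx : x ∈ rect) :
    ENNReal.ofReal ((1 / 4) ^ p / 4 ^ ((2 : ℝ) + δ * p) * Real.pi) *
        ENNReal.ofReal (x 1 ^ (-1 : ℝ)) ≤ ∫⁻ y in domain,
        ENNReal.ofReal (|jump x - jump y| ^ p / dist x y ^ ((2 : ℝ) + δ * p)) := by
  obtain ⟨⟨h1, h2⟩, h3, h4⟩ := hx
  set s := x 1 with hs
  set z : E := !₂[x 0, -2 * s] with hz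
  have hz0 : z 0 = x 0 := rfl
  have hz1 : z 1 = -2 * s := rfl
  have hlow {y : E} (hy : y ∈ ball z s) : y 1 < 0 := by
    have := (abs_lt.1 ((abs_coord_sub_le y z 1).trans_lt hy)).2
    linarith
  have hsub : ball z s ⊆ domain := by
    intro y hy
    refine Or.inl (Or.inr ⟨?_, hlow hy⟩)
    have a0 := abs_lt.1 ((abs_coord_sub_le y z 0).trans_lt hy)
    have a1 := abs_lt.1 ((abs_coord_sub_le y z 1).trans_lt hy)
    rw [mem_ball_iff one_pos]
    simp only [PiLp.zero_apply, sub_zero]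
    rw [hz0] at a0
    rw [hz1] at a1
    have b0 : y 0 ^ 2 ≤ (5 / 8) ^ 2 := sq_le_sq' (by linarith) (by linarith)
    have b1 : y 1 ^ 2 ≤ (3 / 8) ^ 2 := sq_le_sq' (by linarith) (by linarith)
    linarith
  have hxz : dist x z = 3 * s := by
    rw [EuclideanSpace.dist_eq]
    simp only [Fin.sum_univ_two, hz0, hz1, Real.dist_eq, ← hs]
    rw [sub_self, abs_zero, zero_pow two_ne_zero, zero_add, Real.sqrt_sq (abs_nonneg _),
      abs_of_pos] <;> linarith
  calc _ ≤ ENNReal.ofReal ((1 / 4) ^ p / (4 * s) ^ ((2 : ℝ) + δ * p)) * volume (ball z s) := by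
        rw [EuclideanSpace.volume_ball_fin_two, ← ENNReal.ofReal_pow h3.le,
          ← ENNReal.ofReal_mul (by positivity), ← ENNReal.ofReal_mul (by positivity),
          ← ENNReal.ofReal_mul (by positivity)]
        refine ENNReal.ofReal_le_ofReal ?_
        have hpow : s ^ (-1 : ℝ) ≤ s ^ (2 : ℕ) / s ^ ((2 : ℝ) + δ * p) := by
          rw [← Real.rpow_natCast, ← Real.rpow_sub h3]
          exact Real.rpow_le_rpow_of_exponent_ge h3 (by linarith) (by push_cast; linarith)
        rw [Real.mul_rpow (by norm_num) h3.le]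
        calc _ ≤ (1 / 4) ^ p / 4 ^ ((2 : ℝ) + δ * p) * Real.pi *
              (s ^ (2 : ℕ) / s ^ ((2 : ℝ) + δ * p)) := by gcongr
          _ = _ := by field_simp
    _ = ∫⁻ _ in ball z s, ENNReal.ofReal ((1 / 4) ^ p / (4 * s) ^ ((2 : ℝ) + δ * p)) :=
        (setLIntegral_const _ _).symm
    _ ≤ ∫⁻ y in ball z s,
        ENNReal.ofReal (|jump x - jump y| ^ p / dist x y ^ ((2 : ℝ) + δ * p)) := by
        refine setLIntegral_mono' measurableSet_ball fun y hy => ENNReal.ofReal_le_ofReal ?_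
        have hd0 : 0 < dist x y := dist_pos.2 fun h => by
          have := hlow hy
          rw [← h] at this
          linarith
        have hd : dist x y ≤ 4 * s := by
          linarith [dist_triangle_right x y z, mem_ball.1 hy]
        have hj : 1 / 4 ≤ |jump x - jump y| := by
          rw [jump, jump, if_pos h3, if_neg (hlow hy).not_gt, sub_zero]
          exact h1.le.trans ((le_max_right _ _).trans (le_abs_self _))
        have : 0 ≤ (2 : ℝ) + δ * p := by linarith
        gcongr
    _ ≤ _ := lintegral_mono_set hsub

lemma full_eq_top {p δ : ℝ} (hp : 1 ≤ p) (hpδ : 1 ≤ p * δ) :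
    ∫⁻ x in domain, ∫⁻ y in domain,
      ENNReal.ofReal (|jump x - jump y| ^ p / dist x y ^ ((2 : ℝ) + δ * p)) = ∞ := by
  refine top_unique ?_
  calc ∞ = ENNReal.ofReal ((1 / 4) ^ p / 4 ^ ((2 : ℝ) + δ * p) * Real.pi) *
        ∫⁻ x in rect, ENNReal.ofReal (x 1 ^ (-1 : ℝ)) := by
        rw [lintegral_rect, ENNReal.mul_top]
        exact (ENNReal.ofReal_pos.2 (by positivity)).ne'
    _ = ∫⁻ x in rect, ENNReal.ofReal ((1 / 4) ^ p / 4 ^ ((2 : ℝ) + δ * p) * Real.pi) *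
        ENNReal.ofReal (x 1 ^ (-1 : ℝ)) := (lintegral_const_mul' _ _ ENNReal.ofReal_ne_top).symm
    _ ≤ ∫⁻ x in rect, ∫⁻ y in domain,
        ENNReal.ofReal (|jump x - jump y| ^ p / dist x y ^ ((2 : ℝ) + δ * p)) :=
        setLIntegral_mono' measurableSet_rect fun x hx => full_inner_ge hp hpδ hx
    _ ≤ _ := lintegral_mono_set rect_subset

end SlitDisc

/-- Proposition 3.4: for `1 ≤ p < ∞`, `0 < δ < 1` with `pδ ≥ 1` and `τ = 1`, there is a
John domain `G ⊆ ℝ²` on which the full fractional seminorm is not controlled by the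
improved one: in fact there is `u ∈ L¹(G)` with finite improved seminorm and infinite
full seminorm. -/
theorem no_comparability_on_john_domain
    {p δ : ℝ} (hp : 1 ≤ p) (hδ : δ ∈ Set.Ioo (0 : ℝ) 1) (hpδ : 1 ≤ p * δ) :
    ∃ (c : ℝ) (G : Set (EuclideanSpace ℝ (Fin 2))), IsJohnDomain c G ∧
      (¬ ∃ C : ℝ, 0 < C ∧ ∀ u : EuclideanSpace ℝ (Fin 2) → ℝ, IntegrableOn u G volume →
        (∫⁻ x in G, ∫⁻ y in G,
            ENNReal.ofReal (|u x - u y| ^ p / dist x y ^ ((2 : ℝ) + δ * p))) ≤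
          ENNReal.ofReal C *
            ∫⁻ x in G, ∫⁻ y in Metric.ball x (1 * Metric.infDist x (frontier G)),
              ENNReal.ofReal (|u x - u y| ^ p / dist x y ^ ((2 : ℝ) + δ * p))) ∧
      ∃ u : EuclideanSpace ℝ (Fin 2) → ℝ, IntegrableOn u G volume ∧
        (∫⁻ x in G, ∫⁻ y in Metric.ball x (1 * Metric.infDist x (frontier G)),
            ENNReal.ofReal (|u x - u y| ^ p / dist x y ^ ((2 : ℝ) + δ * p))) < ∞ ∧
        (∫⁻ x in G, ∫⁻ y in G,
            ENNReal.ofReal (|u x - u y| ^ p / dist x y ^ ((2 : ℝ) + δ * p))) = ∞ := by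
  have hfin := SlitDisc.improved_lt_top hp hδ
  have htop := SlitDisc.full_eq_top hp hpδ
  refine ⟨32, SlitDisc.domain, SlitDisc.isJohnDomain_domain, ?_, SlitDisc.jump,
    SlitDisc.integrableOn_jump, hfin, htop⟩
  rintro ⟨C, -, hC⟩
  have h := hC _ SlitDisc.integrableOn_jump
  rw [htop] at h
  exact (h.trans_lt (ENNReal.mul_lt_top ENNReal.ofReal_lt_top hfin)).false
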